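/- arXiv:2510.25343 — 2 statements merged into one kernel-verified Lean document; each statement's English description precedes it below -/
import Mathlib

section
/- Distributed leftover hash lemma: Let ε > 0, ε' ≥ 0, and for 1 ≤ i ≤ m let gᵢ : 𝒯ᵢ × 𝒳ᵢ → {0,1}^{nᵢ} be two-universal hash functions (𝒯ᵢ, 𝒳ᵢ finite). Let X₁,…,X_m and Z be random variables with Xᵢ taking values in 𝒳ᵢ, such that for every nonempty subset S ⊆ {1,…,m}, the smooth min-entropy of the tuple X_S = (Xᵢ)_{i∈S} satisfies H^{ε'}_∞(X_S | Z) ≥ Σ_{i∈S} nᵢ + 2 log₂(1/ε). Let T₁,…,T_m be uniformly distributed on 𝒯₁,…,𝒯_m, mutually independent and independent of (X₁,…,X_m, Z). Then the joint distribution of ((g₁(T₁,X₁),…,g_m(T_m,X_m)), T₁,…,T_m, Z) is within statistical distance 2^m ε/2 + 2^m ε' of the product of the uniform distribution on {0,1}^{n₁+⋯+n_m} with the joint distribution of (T₁,…,T_m, Z). -/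
open scoped BigOperators Classical

noncomputable section

namespace OT

variable {Ω : Type*} [Fintype Ω]

/-- Probability of an event under a pmf on a finite sample space. -/
def pr (μ : Ω → ℝ) (s : Set Ω) : ℝ := ∑ ω, s.indicator μ ω

/-- `q` is a probability mass function on a finite type. -/
def isDist {α : Type*} [Fintype α] (q : α → ℝ) : Prop := (∀ a, 0 ≤ q a) ∧ ∑ a, q a = 1

/-- Distribution (pmf) of a random variable. -/
def dst {α : Type*} (μ : Ω → ℝ) (X : Ω → α) : α → ℝ := fun a => pr μ {ω | X ω = a}

/-- Joint distribution of two random variables. -/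
def jd {α β : Type*} (μ : Ω → ℝ) (X : Ω → α) (Y : Ω → β) : α × β → ℝ :=
  fun q => pr μ {ω | X ω = q.1 ∧ Y ω = q.2}

/-- Conditional pmf given an event. -/
def cnd (μ : Ω → ℝ) (s : Set Ω) : Ω → ℝ := fun ω => s.indicator μ ω / pr μ s

/-- Shannon entropy (in bits) of a pmf on a finite type. -/
def entD {α : Type*} [Fintype α] (q : α → ℝ) : ℝ := ∑ a, -(q a * Real.logb 2 (q a))

/-- Shannon entropy (in bits) of a random variable. -/
def ent {α : Type*} [Fintype α] (μ : Ω → ℝ) (X : Ω → α) : ℝ := entD (dst μ X)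

/-- Conditional Shannon entropy `H(X|Y)` (in bits). -/
def condEnt {α β : Type*} [Fintype α] [Fintype β] (μ : Ω → ℝ) (X : Ω → α) (Y : Ω → β) : ℝ :=
  ent μ (fun ω => (X ω, Y ω)) - ent μ Y

/-- Mutual information `I(X;Y)` (in bits). -/
def mi {α β : Type*} [Fintype α] [Fintype β] (μ : Ω → ℝ) (X : Ω → α) (Y : Ω → β) : ℝ :=
  ent μ X + ent μ Y - ent μ (fun ω => (X ω, Y ω))

/-- Conditional mutual information `I(X;Y|Z)` (in bits). -/
def cmi {α β γ : Type*} [Fintype α] [Fintype β] [Fintype γ]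
    (μ : Ω → ℝ) (X : Ω → α) (Y : Ω → β) (Z : Ω → γ) : ℝ :=
  ent μ (fun ω => (X ω, Z ω)) + ent μ (fun ω => (Y ω, Z ω))
    - ent μ (fun ω => (X ω, Y ω, Z ω)) - ent μ Z

/-- Rényi entropy of order two (in bits). -/
def ren2 {α : Type*} [Fintype α] (μ : Ω → ℝ) (X : Ω → α) : ℝ :=
  Real.logb 2 (1 / ∑ a, (dst μ X a) ^ 2)

/-- Statistical (total variation) distance between two pmfs. -/
def sd {α : Type*} [Fintype α] (q q' : α → ℝ) : ℝ := (∑ a, |q a - q' a|) / 2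

/-- Conditional min-entropy `H∞(X|Y)` of a joint pmf (in bits):
the minimum over `(a,b)` in the support of `log₂ (P(Y=b) / P(X=a, Y=b))`. -/
def minEnt {α β : Type*} [Fintype α] [Fintype β] (q : α × β → ℝ) : ℝ :=
  sInf {r | ∃ a b, 0 < q (a, b) ∧ r = Real.logb 2 ((∑ a', q (a', b)) / q (a, b))}

/-- `ε`-smooth conditional min-entropy of a joint pmf (in bits). -/
def sminEnt {α β : Type*} [Fintype α] [Fintype β] (q : α × β → ℝ) (ε : ℝ) : ℝ :=
  sSup {r | ∃ q' : α × β → ℝ, isDist q' ∧ sd q q' ≤ ε ∧ r = minEnt q'}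

/-- Conditional zero-entropy `H₀(X|Y)` of a joint pmf (in bits). -/
def zeroEnt {α β : Type*} [Fintype α] [Fintype β] (q : α × β → ℝ) : ℝ :=
  sSup {r | ∃ b, 0 < ∑ a, q (a, b) ∧
    r = Real.logb 2 ((Finset.univ.filter fun a => 0 < q (a, b)).card)}

end OT

open OT

theorem jd_eq {Ω α β : Type*} [Fintype Ω] (μ : Ω → ℝ) (X : Ω → α) (Y : Ω → β) (a : α) (b : β) :
    jd μ X Y (a, b) = ∑ ω, if X ω = a ∧ Y ω = b then μ ω else 0 := by
  unfold jd pr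
  refine Finset.sum_congr rfl fun ω _ => ?_
  simp [Set.indicator]

theorem jd_sum_mul {Ω α β : Type*} [Fintype Ω] [Fintype α] [Fintype β] (μ : Ω → ℝ) (X : Ω → α)
    (Y : Ω → β) (f : α × β → ℝ) :
    ∑ v, jd μ X Y v * f v = ∑ ω, μ ω * f (X ω, Y ω) := by
  have : ∀ v, jd μ X Y v * f v = ∑ ω, if (X ω, Y ω) = v then μ ω * f v else 0 := by
    rintro ⟨a, b⟩
    rw [jd_eq, Finset.sum_mul]
    refine Finset.sum_congr rfl fun ω _ => ?_
    simp [Prod.ext_iff]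
  simp_rw [this]
  rw [Finset.sum_comm]
  refine Finset.sum_congr rfl fun ω _ => ?_
  simp

theorem jd_isDist {Ω α β : Type*} [Fintype Ω] [Fintype α] [Fintype β] (μ : Ω → ℝ) (X : Ω → α)
    (Y : Ω → β) (hμ : isDist μ) : isDist (jd μ X Y) := by
  constructor
  · rintro ⟨a, b⟩
    rw [jd_eq]
    exact Finset.sum_nonneg fun ω _ => by split_ifs <;> simp [hμ.1]
  · have := jd_sum_mul μ X Y (fun _ => 1)
    simpa [hμ.2] using this

theorem trunc {Ω α ζ : Type*} [Fintype Ω] [Fintype α] [Fintype ζ] (μ : Ω → ℝ) (hμ : isDist μ)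
    (W : Ω → α) (Z : Ω → ζ) (ε' K : ℝ) (hε' : 0 ≤ ε') (hK : K < sminEnt (jd μ W Z) ε') :
    ∃ (r : Ω → ℝ) (Q : ζ → ℝ), (∀ ω, 0 ≤ r ω) ∧ (∀ ω, r ω ≤ 1) ∧
      ∑ ω, μ ω * (1 - r ω) ≤ ε' ∧ (∀ z, 0 ≤ Q z) ∧ ∑ z, Q z = 1 ∧
      ∀ ω, (∑ ω', if W ω' = W ω ∧ Z ω' = Z ω then μ ω' * r ω' else 0)
        ≤ (2:ℝ) ^ (-K) * Q (Z ω) := by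
  have hp := jd_isDist μ W Z hμ
  have hne : {r | ∃ q' : α × ζ → ℝ, isDist q' ∧ sd (jd μ W Z) q' ≤ ε' ∧ r = minEnt q'}.Nonempty :=
    ⟨_, jd μ W Z, hp, by simpa [sd] using hε', rfl⟩
  obtain ⟨_, ⟨q, hq, hsd, rfl⟩, hKq⟩ := exists_lt_of_lt_csSup hne hK
  set p := jd μ W Z with hpdef
  have hbound : ∀ a b, q (a, b) ≤ (2:ℝ) ^ (-K) * ∑ a', q (a', b) := by
    intro a b
    have hs : q (a, b) ≤ ∑ a', q (a', b) :=
      Finset.single_le_sum (f := fun a' => q (a', b)) (fun i _ => hq.1 _) (Finset.mem_univ a)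
    rcases (hq.1 (a, b)).eq_or_lt with h | h
    · rw [← h] at hs ⊢
      positivity
    · have hlt : K < Real.logb 2 ((∑ a', q (a', b)) / q (a, b)) := by
        refine hKq.trans_le (csInf_le ⟨0, ?_⟩ ⟨a, b, h, rfl⟩)
        rintro _ ⟨a, b, h, rfl⟩
        refine Real.logb_nonneg (by norm_num) ?_
        rw [le_div_iff₀ h, one_mul]
        exact Finset.single_le_sum (f := fun a' => q (a', b)) (fun i _ => hq.1 _) (Finset.mem_univ a)
      rw [Real.lt_logb_iff_rpow_lt (by norm_num) (div_pos (h.trans_le hs) h), lt_div_iff₀ h] at hlt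
      rw [Real.rpow_neg (by norm_num), inv_mul_eq_div, le_div_iff₀ (by positivity)]
      linarith
  let R : α × ζ → ℝ := fun v => min 1 (q v / p v)
  have hRp : ∀ v, p v * R v ≤ q v := by
    intro v
    rcases (hp.1 v).eq_or_lt with h | h
    · rw [← h]; simpa using hq.1 v
    · calc p v * R v ≤ p v * (q v / p v) := by
            gcongr
            exact min_le_right _ _
        _ = q v := by field_simp
  refine ⟨fun ω => R (W ω, Z ω), fun z => ∑ a, q (a, z), ?_, ?_, ?_, ?_, ?_, ?_⟩
  · intro ω
    exact le_min zero_le_one (div_nonneg (hq.1 _) (hp.1 _))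
  · intro ω
    exact min_le_left _ _
  · rw [← jd_sum_mul μ W Z (fun v => 1 - R v), ← hpdef]
    refine le_trans ?_ hsd
    have : sd p q = ∑ v, (|p v - q v| + (p v - q v)) / 2 := by
      rw [← Finset.sum_div, Finset.sum_add_distrib, Finset.sum_sub_distrib, hp.2, hq.2]
      simp [sd]
    rw [this]
    refine Finset.sum_le_sum fun v _ => ?_
    rcases (hp.1 v).eq_or_lt with h | h
    · rw [← h]; simp
      linarith [neg_abs_le (-q v), abs_neg (q v), le_abs_self (q v)]
    · have h1 := le_abs_self (p v - q v)
      have h2 := neg_abs_le (p v - q v)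
      rcases min_choice 1 (q v / p v) with h3 | h3
      · simp only [R, h3]; linarith
      · simp only [R, h3]
        have : p v * (1 - q v / p v) = p v - q v := by field_simp
        linarith
  · intro z
    exact Finset.sum_nonneg fun a _ => hq.1 _
  · rw [Finset.sum_comm, ← Fintype.sum_prod_type' (f := fun a z => q (a, z))]
    exact hq.2
  · intro ω
    refine le_trans ?_ (hbound (W ω) (Z ω))
    refine le_trans (le_of_eq ?_) (hRp (W ω, Z ω))
    rw [hpdef, jd_eq, Finset.sum_mul]
    refine Finset.sum_congr rfl fun ω' _ => ?_
    split_ifs with h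
    · simp only [h.1, h.2]
    · simp

/-- product of truncation factors -/
theorem one_sub_prod_le {ι : Type*} (s : Finset ι) (f : ι → ℝ) (h0 : ∀ i ∈ s, 0 ≤ f i)
    (h1 : ∀ i ∈ s, f i ≤ 1) : 1 - ∏ i ∈ s, f i ≤ ∑ i ∈ s, (1 - f i) := by
  induction s using Finset.induction_on with
  | empty => simp
  | insert a s ha ih =>
    rw [Finset.prod_insert ha, Finset.sum_insert ha]
    have h2 := ih (fun i hi => h0 i (Finset.mem_insert_of_mem hi))
      (fun i hi => h1 i (Finset.mem_insert_of_mem hi))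
    have h3 : ∏ i ∈ s, f i ≤ 1 := Finset.prod_le_one
      (fun i hi => h0 i (Finset.mem_insert_of_mem hi))
      (fun i hi => h1 i (Finset.mem_insert_of_mem hi))
    have h4 := h0 a (Finset.mem_insert_self _ _)
    have h5 := h1 a (Finset.mem_insert_self _ _)
    nlinarith

theorem coll_bound (m : ℕ)
    (T X : Fin m → Type*) [∀ i, Fintype (T i)] [∀ i, Nonempty (T i)]
    (n : Fin m → ℕ) (g : ∀ i, T i → X i → (Fin (n i) → Bool))
    (hg : ∀ i, ∀ x x' : X i, x ≠ x' →
      ((Finset.univ.filter fun t : T i => g i t x = g i t x').card : ℝ) / Fintype.card (T i)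
        ≤ 2 ^ (-(n i : ℝ))) (x x' : ∀ i, X i) :
    (∑ t : ∀ i, T i, ((if (fun i => g i (t i) (x i)) = (fun i => g i (t i) (x' i)) then (1:ℝ) else 0)
        - 1 / 2 ^ (∑ i, n i)))
      ≤ (∏ i, (Fintype.card (T i) : ℝ)) * ∑ S ∈ Finset.univ.filter (fun S : Finset (Fin m) => S.Nonempty),
        (if ∀ i ∈ S, x i = x' i then (2:ℝ) ^ (∑ i ∈ S, n i) / 2 ^ (∑ i, n i) else 0) := by
  have e1 : (∑ t : ∀ i, T i, (if (fun i => g i (t i) (x i)) = (fun i => g i (t i) (x' i)) then (1:ℝ) else 0))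
      = ∏ i, ∑ t : T i, (if g i t (x i) = g i t (x' i) then (1:ℝ) else 0) := by
    rw [Fintype.prod_sum]
    refine Finset.sum_congr rfl fun t _ => ?_
    rw [Finset.prod_ite_zero]
    simp [funext_iff]
  let A : Finset (Fin m) := Finset.univ.filter fun i => x i = x' i
  have e2 : ∏ i, ∑ t : T i, (if g i t (x i) = g i t (x' i) then (1:ℝ) else 0)
      ≤ ∏ i, ((Fintype.card (T i) : ℝ) * ((if i ∈ A then (2:ℝ) ^ (n i) else 1) / 2 ^ (n i))) := by
    refine Finset.prod_le_prod (fun i _ => Finset.sum_nonneg fun t _ => by split_ifs <;> simp)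
      fun i _ => ?_
    by_cases h : x i = x' i
    · have : i ∈ A := by simp [A, h]
      simp [h, this]
    · have hA : i ∉ A := by simp [A, h]
      have h2 := hg i _ _ h
      have hc : (0:ℝ) < Fintype.card (T i) := by exact_mod_cast Fintype.card_pos
      rw [div_le_iff₀ hc, Real.rpow_neg (by norm_num), Real.rpow_natCast] at h2
      rw [Finset.sum_boole]
      simp only [hA, if_false, one_div]
      linarith
  have e3 : ∏ i, ((Fintype.card (T i) : ℝ) * ((if i ∈ A then (2:ℝ) ^ (n i) else 1) / 2 ^ (n i)))
      = (∏ i, (Fintype.card (T i) : ℝ)) * ((2:ℝ) ^ (∑ i ∈ A, n i) / 2 ^ (∑ i, n i)) := by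
    rw [Finset.prod_mul_distrib, Finset.prod_div_distrib, Finset.prod_pow_eq_pow_sum]
    congr 2
    rw [← Finset.prod_pow_eq_pow_sum]
    simp
  have hT : (0:ℝ) ≤ ∏ i, (Fintype.card (T i) : ℝ) := Finset.prod_nonneg fun i _ => by positivity
  rw [Finset.sum_sub_distrib, e1]
  simp only [Finset.sum_const, Finset.card_univ, Fintype.card_pi, nsmul_eq_mul, Nat.cast_prod]
  have e4 := e2.trans_eq e3
  rw [sub_le_iff_le_add, ← mul_add]
  refine e4.trans (mul_le_mul_of_nonneg_left ?_ hT)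
  have hnn : ∀ S : Finset (Fin m),
      (0:ℝ) ≤ (if ∀ i ∈ S, x i = x' i then (2:ℝ) ^ (∑ i ∈ S, n i) / 2 ^ (∑ i, n i) else 0) := by
    intro S
    split_ifs <;> positivity
  rcases A.eq_empty_or_nonempty with h | h
  · rw [h]
    have := Finset.sum_nonneg (s := Finset.univ.filter (fun S : Finset (Fin m) => S.Nonempty))
      (fun S _ => hnn S)
    simpa using this
  · have := Finset.single_le_sum (s := Finset.univ.filter (fun S : Finset (Fin m) => S.Nonempty))
      (fun S _ => hnn S) (a := A) (by simp [h])
    have hA : ∀ i ∈ A, x i = x' i := by simp [A]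
    rw [if_pos hA] at this
    have : (0:ℝ) ≤ 1 / 2 ^ (∑ i, n i) := by positivity
    linarith

theorem sqsum {Y : Type*} [Fintype Y] [Nonempty Y] {Ω : Type*} [Fintype Ω] (ν : Ω → ℝ) (h : Ω → Y) :
    ∑ y, (∑ ω, ν ω * ((if h ω = y then (1:ℝ) else 0) - 1 / Fintype.card Y)) ^ 2
      = ∑ ω, ∑ ω', ν ω * ν ω' * ((if h ω = h ω' then (1:ℝ) else 0) - 1 / Fintype.card Y) := by
  simp_rw [sq, Finset.sum_mul_sum]
  rw [Finset.sum_comm]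
  refine Finset.sum_congr rfl fun ω _ => ?_
  rw [Finset.sum_comm]
  refine Finset.sum_congr rfl fun ω' _ => ?_
  have hc : (Fintype.card Y : ℝ) ≠ 0 := by exact_mod_cast Fintype.card_ne_zero
  have : ∀ y, ν ω * ((if h ω = y then (1:ℝ) else 0) - 1 / Fintype.card Y) *
      (ν ω' * ((if h ω' = y then (1:ℝ) else 0) - 1 / Fintype.card Y))
      = ν ω * ν ω' * ((if h ω = y then (if h ω' = y then (1:ℝ) else 0) else 0)
        - (if h ω = y then (1:ℝ) else 0) * (1 / Fintype.card Y)
        - (if h ω' = y then (1:ℝ) else 0) * (1 / Fintype.card Y)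
        + 1 / Fintype.card Y * (1 / Fintype.card Y)) := by
    intro y
    split_ifs <;> ring
  simp_rw [this]
  rw [← Finset.mul_sum, Finset.sum_add_distrib, Finset.sum_sub_distrib, Finset.sum_sub_distrib,
    ← Finset.sum_mul, ← Finset.sum_mul]
  simp only [Finset.sum_ite_eq, Finset.mem_univ, if_true, Finset.sum_const, Finset.card_univ,
    nsmul_eq_mul]
  congr 1
  rw [← mul_assoc, mul_one_div_cancel hc]
  simp only [eq_comm]
  ring

theorem core {Ω : Type*} [Fintype Ω] (m : ℕ)
    (T X : Fin m → Type*) [∀ i, Fintype (T i)] [∀ i, Nonempty (T i)]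
    (n : Fin m → ℕ) (g : ∀ i, T i → X i → (Fin (n i) → Bool))
    (hg : ∀ i, ∀ x x' : X i, x ≠ x' →
      ((Finset.univ.filter fun t : T i => g i t x = g i t x').card : ℝ) / Fintype.card (T i)
        ≤ 2 ^ (-(n i : ℝ)))
    (Xr : ∀ i, Ω → X i) (ν : Ω → ℝ) (hν : ∀ ω, 0 ≤ ν ω) (ε : ℝ) (hε : 0 < ε)
    (q : Finset (Fin m) → ℝ) (hq : ∀ S, 0 ≤ q S)
    (hS : ∀ S : Finset (Fin m), S.Nonempty → ∀ ω, ν ω ≠ 0 →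
      (∑ ω', if ∀ i ∈ S, Xr i ω = Xr i ω' then ν ω' else 0) ≤ ε ^ 2 / 2 ^ (∑ i ∈ S, n i) * q S) :
    ∑ t : ∀ i, T i, ∑ y : ∀ i, Fin (n i) → Bool,
      |∑ ω, ν ω * ((if (fun i => g i (t i) (Xr i ω)) = y then (1:ℝ) else 0) - 1 / 2 ^ (∑ i, n i))|
    ≤ (∏ i, (Fintype.card (T i) : ℝ)) * ε *
      ∑ S ∈ Finset.univ.filter (fun S : Finset (Fin m) => S.Nonempty), (q S + ∑ ω, ν ω) / 2 := by
  set F := Finset.univ.filter (fun S : Finset (Fin m) => S.Nonempty) with hF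
  set M : ℝ := ∏ i, (Fintype.card (T i) : ℝ) with hM
  set N := ∑ i, n i with hN
  have hM0 : 0 ≤ M := Finset.prod_nonneg fun i _ => by positivity
  have hY : (Fintype.card (∀ i, Fin (n i) → Bool) : ℝ) = 2 ^ N := by
    simp [hN, Finset.prod_pow_eq_pow_sum]
  have hTc : (Fintype.card (∀ i, T i) : ℝ) = M := by simp [hM]
  set D : (∀ i, T i) → (∀ i, Fin (n i) → Bool) → ℝ := fun t y =>
    ∑ ω, ν ω * ((if (fun i => g i (t i) (Xr i ω)) = y then (1:ℝ) else 0) - 1 / 2 ^ N) with hD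
  have hP : 0 ≤ ∑ ω, ν ω := Finset.sum_nonneg fun ω _ => hν ω
  have hsq : ∑ t, ∑ y, D t y ^ 2 ≤ M * ((ε ^ 2 / 2 ^ N) * ∑ S ∈ F, q S * ∑ ω, ν ω) := by
    have h1 : ∀ t, ∑ y, D t y ^ 2 = ∑ ω, ∑ ω', ν ω * ν ω' *
        ((if (fun i => g i (t i) (Xr i ω)) = (fun i => g i (t i) (Xr i ω')) then (1:ℝ) else 0)
          - 1 / 2 ^ N) := by
      intro t
      have := sqsum ν (fun ω => (fun i => g i (t i) (Xr i ω)))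
      rw [hY] at this
      convert this
    simp_rw [h1]
    rw [Finset.sum_comm]
    calc _ = ∑ ω, ∑ ω', ν ω * ν ω' * ∑ t : ∀ i, T i,
        ((if (fun i => g i (t i) (Xr i ω)) = (fun i => g i (t i) (Xr i ω')) then (1:ℝ) else 0)
          - 1 / 2 ^ N) := by
          refine Finset.sum_congr rfl fun ω _ => ?_
          rw [Finset.sum_comm]
          simp_rw [Finset.mul_sum]
      _ ≤ ∑ ω, ∑ ω', ν ω * ν ω' * (M * ∑ S ∈ F,
          (if ∀ i ∈ S, Xr i ω = Xr i ω' then (2:ℝ) ^ (∑ i ∈ S, n i) / 2 ^ N else 0)) := by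
          refine Finset.sum_le_sum fun ω _ => Finset.sum_le_sum fun ω' _ => ?_
          refine mul_le_mul_of_nonneg_left ?_ (mul_nonneg (hν _) (hν _))
          exact coll_bound m T X n g hg (fun i => Xr i ω) (fun i => Xr i ω')
      _ = M * ∑ S ∈ F, ∑ ω, (2:ℝ) ^ (∑ i ∈ S, n i) / 2 ^ N * (ν ω *
          ∑ ω', if ∀ i ∈ S, Xr i ω = Xr i ω' then ν ω' else 0) := by
          rw [Finset.sum_comm (s := F), Finset.mul_sum]
          refine Finset.sum_congr rfl fun ω _ => ?_
          simp_rw [Finset.mul_sum]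
          rw [Finset.sum_comm]
          refine Finset.sum_congr rfl fun S _ => Finset.sum_congr rfl fun ω' _ => ?_
          split_ifs <;> ring
      _ ≤ M * ∑ S ∈ F, ∑ ω, (2:ℝ) ^ (∑ i ∈ S, n i) / 2 ^ N * (ν ω *
          (ε ^ 2 / 2 ^ (∑ i ∈ S, n i) * q S)) := by
          refine mul_le_mul_of_nonneg_left ?_ hM0
          refine Finset.sum_le_sum fun S hSF => Finset.sum_le_sum fun ω _ => ?_
          refine mul_le_mul_of_nonneg_left ?_ (by positivity)
          by_cases h0 : ν ω = 0
          · simp [h0]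
          · exact mul_le_mul_of_nonneg_left (hS S (by simpa [hF] using hSF) ω h0) (hν ω)
      _ = _ := by
          congr 1
          rw [Finset.mul_sum]
          refine Finset.sum_congr rfl fun S _ => ?_
          rw [Finset.mul_sum, Finset.mul_sum]
          refine Finset.sum_congr rfl fun ω _ => ?_
          field_simp
  have hcs : (∑ t, ∑ y, |D t y|) ^ 2 ≤ (M * 2 ^ N) * ∑ t, ∑ y, D t y ^ 2 := by
    have := sq_sum_le_card_mul_sum_sq (s := (Finset.univ : Finset ((∀ i, T i) × (∀ i, Fin (n i) → Bool))))
      (f := fun v => |D v.1 v.2|)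
    rw [Fintype.sum_prod_type, Fintype.sum_prod_type, Finset.card_univ, Fintype.card_prod,
      Nat.cast_mul, hTc, hY] at this
    simpa only [sq_abs] using this
  have hfin : ∑ S ∈ F, q S * ∑ ω, ν ω ≤ (∑ S ∈ F, (q S + ∑ ω, ν ω) / 2) ^ 2 := by
    refine le_trans (Finset.sum_le_sum fun S _ => ?_)
      (Finset.sum_sq_le_sq_sum_of_nonneg (fun S _ => ?_))
    · nlinarith [sq_nonneg (q S - ∑ ω, ν ω)]
    · have := hq S
      positivity
  have hR : 0 ≤ ∑ S ∈ F, (q S + ∑ ω, ν ω) / 2 := Finset.sum_nonneg fun S _ => by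
    have := hq S
    positivity
  refine abs_le_of_sq_le_sq' ?_ (by positivity) |>.2
  calc _ ≤ (M * 2 ^ N) * ∑ t, ∑ y, D t y ^ 2 := hcs
    _ ≤ (M * 2 ^ N) * (M * ((ε ^ 2 / 2 ^ N) * ∑ S ∈ F, q S * ∑ ω, ν ω)) := by gcongr
    _ ≤ (M * 2 ^ N) * (M * ((ε ^ 2 / 2 ^ N) * (∑ S ∈ F, (q S + ∑ ω, ν ω) / 2) ^ 2)) := by gcongr
    _ = _ := by field_simp

theorem exists_trunc {Ω ζ : Type*} [Fintype Ω] [Fintype ζ] (m : ℕ)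
    (X : Fin m → Type*) [∀ i, Fintype (X i)]
    (n : Fin m → ℕ) (μ : Ω → ℝ) (hμ : isDist μ)
    (Xr : ∀ i, Ω → X i) (Z : Ω → ζ)
    (ε ε' ε₁ : ℝ) (hε : 0 < ε) (hε' : 0 ≤ ε') (hε₁ : ε < ε₁)
    (hmin : ∀ S : Finset (Fin m), S.Nonempty →
      sminEnt (jd μ (fun ω (i : {i // i ∈ S}) => Xr i.1 ω) Z) ε'
        ≥ (∑ i ∈ S, (n i : ℝ)) + 2 * Real.logb 2 (1 / ε)) :
    ∃ (μ' : Ω → ℝ) (Q : Finset (Fin m) → ζ → ℝ), (∀ ω, 0 ≤ μ' ω) ∧ (∀ ω, μ' ω ≤ μ ω) ∧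
      ∑ ω, (μ ω - μ' ω) ≤ 2 ^ m * ε' ∧ (∀ S z, 0 ≤ Q S z) ∧ (∀ S, ∑ z, Q S z ≤ 1) ∧
      ∀ S : Finset (Fin m), S.Nonempty → ∀ ω,
        (∑ ω', if (∀ i ∈ S, Xr i ω = Xr i ω') ∧ Z ω' = Z ω then μ' ω' else 0)
          ≤ ε₁ ^ 2 / 2 ^ (∑ i ∈ S, n i) * Q S (Z ω) := by
  have h : ∀ S : Finset (Fin m), ∃ (r : Ω → ℝ) (Q : ζ → ℝ), (∀ ω, 0 ≤ r ω) ∧ (∀ ω, r ω ≤ 1) ∧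
      ∑ ω, μ ω * (1 - r ω) ≤ ε' ∧ (∀ z, 0 ≤ Q z) ∧ ∑ z, Q z ≤ 1 ∧
      (S.Nonempty → ∀ ω, (∑ ω', if (∀ i ∈ S, Xr i ω = Xr i ω') ∧ Z ω' = Z ω then μ ω' * r ω' else 0)
        ≤ ε₁ ^ 2 / 2 ^ (∑ i ∈ S, n i) * Q (Z ω)) := by
    intro S
    by_cases hS : S.Nonempty
    · have hpos : 0 < ε₁ := hε.trans hε₁
      have hlt : (∑ i ∈ S, (n i : ℝ)) + 2 * Real.logb 2 (1 / ε₁) <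
          sminEnt (jd μ (fun ω (i : {i // i ∈ S}) => Xr i.1 ω) Z) ε' := by
        refine lt_of_lt_of_le ?_ (hmin S hS)
        have : Real.logb 2 (1 / ε₁) < Real.logb 2 (1 / ε) :=
          Real.logb_lt_logb (by norm_num) (by positivity) (one_div_lt_one_div_of_lt hε hε₁)
        linarith
      obtain ⟨r, Q, h0, h1, h2, h3, h4, h5⟩ := trunc μ hμ _ Z ε' _ hε' hlt
      refine ⟨r, Q, h0, h1, h2, h3, h4.le, fun _ ω => ?_⟩
      have hc : (2:ℝ) ^ (-((∑ i ∈ S, (n i : ℝ)) + 2 * Real.logb 2 (1 / ε₁)))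
          = ε₁ ^ 2 / 2 ^ (∑ i ∈ S, n i) := by
        have : -((∑ i ∈ S, (n i : ℝ)) + 2 * Real.logb 2 (1 / ε₁))
          = Real.logb 2 ε₁ * (2:ℕ) - ((∑ i ∈ S, n i : ℕ) : ℝ) := by
          rw [one_div, Real.logb_inv]; push_cast; ring
        rw [this, Real.rpow_sub (by norm_num), Real.rpow_natCast, Real.rpow_mul (by norm_num),
          Real.rpow_logb (by norm_num) (by norm_num) hpos, Real.rpow_natCast]
      rw [← hc]
      refine le_trans (le_of_eq ?_) (h5 ω)
      refine Finset.sum_congr rfl fun ω' _ => ?_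
      congr 1
      simp only [funext_iff, Subtype.forall, eq_iff_iff]
      simp only [eq_comm]
    · exact ⟨fun _ => 1, fun _ => 0, by simp, by simp, by simpa using hε', by simp, by simp,
        fun h => absurd h hS⟩
  choose r Q h0 h1 h2 h3 h4 h5 using h
  refine ⟨fun ω => μ ω * ∏ S, r S ω, Q, ?_, ?_, ?_, h3, h4, ?_⟩
  · exact fun ω => mul_nonneg (hμ.1 ω) (Finset.prod_nonneg fun S _ => h0 S ω)
  · exact fun ω => mul_le_of_le_one_right (hμ.1 ω)
      (Finset.prod_le_one (fun S _ => h0 S ω) (fun S _ => h1 S ω))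
  · calc ∑ ω, (μ ω - μ ω * ∏ S, r S ω) ≤ ∑ ω, ∑ S, μ ω * (1 - r S ω) := by
          refine Finset.sum_le_sum fun ω _ => ?_
          rw [← Finset.mul_sum]
          have := mul_le_mul_of_nonneg_left (one_sub_prod_le Finset.univ (fun S => r S ω)
            (fun S _ => h0 S ω) (fun S _ => h1 S ω)) (hμ.1 ω)
          linarith
      _ ≤ ∑ S : Finset (Fin m), ε' := by
          rw [Finset.sum_comm]
          exact Finset.sum_le_sum fun S _ => h2 S
      _ = 2 ^ m * ε' := by simp
  · intro S hS ω
    refine le_trans (Finset.sum_le_sum fun ω' _ => ?_) (h5 S hS ω)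
    split_ifs
    · refine mul_le_mul_of_nonneg_left ?_ (hμ.1 ω')
      rw [← Finset.mul_prod_erase Finset.univ (fun S => r S ω') (Finset.mem_univ S)]
      exact mul_le_of_le_one_right (h0 S ω')
        (Finset.prod_le_one (fun S _ => h0 S ω') (fun S _ => h1 S ω'))
    · exact le_rfl

theorem sum_abs_two {Y : Type*} [Fintype Y] (y₀ : Y) (c : ℝ) (hc : c = 1 / Fintype.card Y) :
    ∑ y, |(if y₀ = y then (1:ℝ) else 0) - c| ≤ 2 := by
  have hpos : (0:ℝ) < Fintype.card Y := by
    have : Nonempty Y := ⟨y₀⟩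
    exact_mod_cast Fintype.card_pos
  have hc0 : 0 ≤ c := by rw [hc]; positivity
  calc _ ≤ ∑ y, ((if y₀ = y then (1:ℝ) else 0) + c) := by
        refine Finset.sum_le_sum fun y _ => ?_
        rw [abs_le]
        constructor <;> split_ifs <;> linarith
    _ = 2 := by
        rw [Finset.sum_add_distrib]
        simp [hc, hpos.ne']
        norm_num

theorem diff_eq {Ω τ Y ζ : Type*} [Fintype Ω] [Fintype τ] (μ : Ω → ℝ) (M c : ℝ)
    (h : τ → Ω → Y) (Z : Ω → ζ) (y : Y) (t : τ) (z : ζ) :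
    jd (fun pω : Ω × τ => μ pω.1 / M) (fun pω => h pω.2 pω.1) (fun pω => (pω.2, Z pω.1)) (y, (t, z))
      - c * dst (fun pω : Ω × τ => μ pω.1 / M) (fun pω => (pω.2, Z pω.1)) (t, z)
    = (∑ ω, (if Z ω = z then μ ω else 0) * ((if h t ω = y then (1:ℝ) else 0) - c)) / M := by
  have e1 : jd (fun pω : Ω × τ => μ pω.1 / M) (fun pω => h pω.2 pω.1)
      (fun pω => (pω.2, Z pω.1)) (y, (t, z))
      = ∑ ω, (if Z ω = z then μ ω else 0) * (if h t ω = y then (1:ℝ) else 0) / M := by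
    rw [jd_eq, Fintype.sum_prod_type]
    refine Finset.sum_congr rfl fun ω _ => ?_
    rw [Finset.sum_eq_single t]
    · by_cases h1 : Z ω = z <;> by_cases h2 : h t ω = y <;> simp [h1, h2]
    · intro t' _ ht
      simp [ht]
    · simp
  have e2 : dst (fun pω : Ω × τ => μ pω.1 / M) (fun pω => (pω.2, Z pω.1)) (t, z)
      = ∑ ω, (if Z ω = z then μ ω else 0) / M := by
    unfold dst pr
    rw [Fintype.sum_prod_type]
    refine Finset.sum_congr rfl fun ω _ => ?_
    rw [Finset.sum_eq_single t]
    · by_cases h1 : Z ω = z <;> simp [Set.indicator, h1]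
    · intro t' _ ht
      simp [Set.indicator, ht]
    · simp
  rw [e1, e2, Finset.mul_sum, ← Finset.sum_sub_distrib, Finset.sum_div]
  refine Finset.sum_congr rfl fun ω _ => ?_
  ring

theorem sum_fiber {Ω ζ : Type*} [Fintype Ω] [Fintype ζ] (f : Ω → ℝ) (Z : Ω → ζ) :
    ∑ z, ∑ ω, (if Z ω = z then f ω else 0) = ∑ ω, f ω := by
  rw [Finset.sum_comm]
  simp

/-- Distributed leftover hash lemma: given two-universal hash functions
`gᵢ : 𝒯ᵢ × 𝒳ᵢ → {0,1}^{nᵢ}`, random variables `X₁,…,X_m, Z` with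
`H^{ε'}_∞(X_S | Z) ≥ Σ_{i∈S} nᵢ + 2 log₂(1/ε)` for every nonempty `S ⊆ {1,…,m}`, and
seeds `T₁,…,T_m` uniform and independent of everything (modelled by the product measure
on `Ω × Π i, 𝒯 i`), the joint distribution of `((gᵢ(Tᵢ,Xᵢ))ᵢ, T, Z)` is within statistical
distance `2^m ε/2 + 2^m ε'` of uniform on the hash values times the distribution of `(T,Z)`. -/
theorem statement6 {Ω ζ : Type*} [Fintype Ω] [Fintype ζ] (m : ℕ)
    (T X : Fin m → Type*) [∀ i, Fintype (T i)] [∀ i, Fintype (X i)] [∀ i, Nonempty (T i)]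
    (n : Fin m → ℕ) (g : ∀ i, T i → X i → (Fin (n i) → Bool))
    (hg : ∀ i, ∀ x x' : X i, x ≠ x' →
      ((Finset.univ.filter fun t : T i => g i t x = g i t x').card : ℝ) / Fintype.card (T i)
        ≤ 2 ^ (-(n i : ℝ)))
    (μ : Ω → ℝ) (hμ : isDist μ)
    (Xr : ∀ i, Ω → X i) (Z : Ω → ζ)
    (ε ε' : ℝ) (hε : 0 < ε) (hε' : 0 ≤ ε')
    (hmin : ∀ S : Finset (Fin m), S.Nonempty →
      sminEnt (jd μ (fun ω (i : {i // i ∈ S}) => Xr i.1 ω) Z) ε'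
        ≥ (∑ i ∈ S, (n i : ℝ)) + 2 * Real.logb 2 (1 / ε)) :
    sd (jd (fun pω : Ω × (∀ i, T i) => μ pω.1 / ∏ i, (Fintype.card (T i) : ℝ))
          (fun pω i => g i (pω.2 i) (Xr i pω.1))
          (fun pω => (pω.2, Z pω.1)))
       (fun v => (1 / 2 ^ (∑ i, n i) : ℝ) *
          dst (fun pω : Ω × (∀ i, T i) => μ pω.1 / ∏ i, (Fintype.card (T i) : ℝ))
            (fun pω => (pω.2, Z pω.1)) v.2)
      ≤ 2 ^ m * ε / 2 + 2 ^ m * ε' := by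
  set M : ℝ := ∏ i, (Fintype.card (T i) : ℝ) with hM
  set N := ∑ i, n i with hN
  have hM0 : 0 < M := Finset.prod_pos fun i _ => by exact_mod_cast Fintype.card_pos
  have hY : (Fintype.card (∀ i, Fin (n i) → Bool) : ℝ) = 2 ^ N := by
    simp [hN, Finset.prod_pow_eq_pow_sum]
  have hTc : (Fintype.card (∀ i, T i) : ℝ) = M := by simp [hM]
  let k : Ω → (∀ i, T i) → (∀ i, Fin (n i) → Bool) → ℝ := fun ω t y =>
    (if (fun i => g i (t i) (Xr i ω)) = y then (1:ℝ) else 0) - 1 / 2 ^ N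
  have hL : sd (jd (fun pω : Ω × (∀ i, T i) => μ pω.1 / M)
          (fun pω i => g i (pω.2 i) (Xr i pω.1))
          (fun pω => (pω.2, Z pω.1)))
       (fun v => (1 / 2 ^ N : ℝ) *
          dst (fun pω : Ω × (∀ i, T i) => μ pω.1 / M)
            (fun pω => (pω.2, Z pω.1)) v.2)
      = (∑ z, ∑ t, ∑ y, |∑ ω, (if Z ω = z then μ ω else 0) * k ω t y|) / M / 2 := by
    unfold sd
    congr 1
    rw [Fintype.sum_prod_type, Finset.sum_comm, Fintype.sum_prod_type, Finset.sum_comm,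
      Finset.sum_div]
    refine Finset.sum_congr rfl fun z _ => ?_
    rw [Finset.sum_div]
    refine Finset.sum_congr rfl fun t _ => ?_
    rw [Finset.sum_div]
    refine Finset.sum_congr rfl fun y _ => ?_
    have := diff_eq μ M (1 / 2 ^ N) (fun (t : ∀ i, T i) ω => fun i => g i (t i) (Xr i ω)) Z y t z
    rw [this, abs_div, abs_of_pos hM0]
    congr!
  rw [hL]
  refine le_of_forall_pos_le_add fun δ hδ => ?_
  set ε₁ := ε + 2 * δ / 2 ^ m with hε₁
  have hlt : ε < ε₁ := by
    have : 0 < 2 * δ / 2 ^ m := by positivity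
    linarith
  have hε₁0 : 0 < ε₁ := hε.trans hlt
  obtain ⟨μ', Q, h0, h1, h2, h3, h4, h5⟩ :=
    exists_trunc m X n μ hμ Xr Z ε ε' ε₁ hε hε' hlt hmin
  have hA : ∑ z, ∑ t, ∑ y, |∑ ω, (if Z ω = z then μ' ω else 0) * k ω t y| ≤ M * ε₁ * 2 ^ m := by
    calc _ ≤ ∑ z, M * ε₁ * ∑ S ∈ Finset.univ.filter (fun S : Finset (Fin m) => S.Nonempty),
          (Q S z + ∑ ω, (if Z ω = z then μ' ω else 0)) / 2 := by
          refine Finset.sum_le_sum fun z _ => ?_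
          refine core m T X n g hg Xr (fun ω => if Z ω = z then μ' ω else 0) ?_ ε₁ hε₁0
            (fun S => Q S z) (fun S => h3 S z) ?_
          · intro ω
            split_ifs
            exacts [h0 ω, le_rfl]
          · intro S hS ω hω
            have hz : Z ω = z := by
              by_contra hne
              simp [hne] at hω
            have := h5 S hS ω
            rw [hz] at this
            refine le_trans (le_of_eq ?_) this
            refine Finset.sum_congr rfl fun ω' _ => ?_
            rw [ite_and]
      _ = M * ε₁ * ∑ S ∈ Finset.univ.filter (fun S : Finset (Fin m) => S.Nonempty),
          (∑ z, Q S z + ∑ ω, μ' ω) / 2 := by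
          rw [← Finset.mul_sum, Finset.sum_comm]
          congr 1
          refine Finset.sum_congr rfl fun S _ => ?_
          rw [← Finset.sum_div, Finset.sum_add_distrib, sum_fiber]
      _ ≤ M * ε₁ * ∑ S ∈ Finset.univ.filter (fun S : Finset (Fin m) => S.Nonempty), 1 := by
          gcongr with S
          have h6 := h4 S
          have h7 : ∑ ω, μ' ω ≤ 1 := hμ.2 ▸ Finset.sum_le_sum fun ω _ => h1 ω
          linarith
      _ ≤ M * ε₁ * ∑ S : Finset (Fin m), 1 := by
          gcongr
          simp
      _ = _ := by simp
  have hB : ∑ z, ∑ t, ∑ y, (∑ ω, (if Z ω = z then (μ ω - μ' ω) else 0) * |k ω t y|)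
      ≤ M * (2 * (2 ^ m * ε')) := by
    calc _ = ∑ z, ∑ t, ∑ ω, (if Z ω = z then (μ ω - μ' ω) else 0) * ∑ y, |k ω t y| := by
          refine Finset.sum_congr rfl fun z _ => Finset.sum_congr rfl fun t _ => ?_
          rw [Finset.sum_comm]
          simp_rw [Finset.mul_sum]
      _ ≤ ∑ z, ∑ t : ∀ i, T i, ∑ ω, (if Z ω = z then (μ ω - μ' ω) else 0) * 2 := by
          refine Finset.sum_le_sum fun z _ => Finset.sum_le_sum fun t _ =>
            Finset.sum_le_sum fun ω _ => ?_
          refine mul_le_mul_of_nonneg_left ?_ ?_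
          · have := sum_abs_two (fun i => g i (t i) (Xr i ω)) (1 / 2 ^ N) (by rw [hY])
            refine le_trans (le_of_eq ?_) this
            refine Finset.sum_congr rfl fun y _ => ?_
            congr!
          · split_ifs
            · linarith [h1 ω]
            · exact le_rfl
      _ = M * (2 * ∑ ω, (μ ω - μ' ω)) := by
          simp_rw [← Finset.sum_mul]
          rw [Finset.sum_comm]
          simp_rw [sum_fiber]
          rw [Finset.sum_const, Finset.card_univ, nsmul_eq_mul, hTc]
          ring
      _ ≤ _ := by gcongr
  have hC : ∑ z, ∑ t, ∑ y, |∑ ω, (if Z ω = z then μ ω else 0) * k ω t y|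
      ≤ M * ε₁ * 2 ^ m + M * (2 * (2 ^ m * ε')) := by
    refine le_trans ?_ (add_le_add hA hB)
    simp_rw [← Finset.sum_add_distrib]
    refine Finset.sum_le_sum fun z _ => Finset.sum_le_sum fun t _ =>
      Finset.sum_le_sum fun y _ => ?_
    have e : ∑ ω, (if Z ω = z then μ ω else 0) * k ω t y
        = ∑ ω, (if Z ω = z then μ' ω else 0) * k ω t y
          + ∑ ω, (if Z ω = z then (μ ω - μ' ω) else 0) * k ω t y := by
      rw [← Finset.sum_add_distrib]
      refine Finset.sum_congr rfl fun ω _ => ?_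
      split_ifs <;> ring
    rw [e]
    refine (abs_add_le _ _).trans (add_le_add le_rfl ?_)
    refine (Finset.abs_sum_le_sum_abs _ _).trans (Finset.sum_le_sum fun ω _ => ?_)
    rw [abs_mul]
    refine mul_le_mul_of_nonneg_right (le_of_eq (abs_of_nonneg ?_)) (abs_nonneg _)
    split_ifs
    · linarith [h1 ω]
    · exact le_rfl
  rw [div_div, div_le_iff₀ (by positivity)]
  refine hC.trans (le_of_eq ?_)
  rw [hε₁]
  field_simp
  ring
end
end

section
/- Hash-then-one-time-pad security bound: let (X, Y) be a pair of random variables with X taking values in a finite set 𝒳 and Y in a finite set 𝒴, and suppose H₂(X | Y = y) ≥ c for every y with P(Y = y) > 0, for some real c. Let 𝒦 be a two-universal family of functions from 𝒳 to {0,1}^l, let κ be uniform on 𝒦 and independent of (X, Y), and let M be uniform on {0,1}^l and independent of (X, Y, κ). Then I(M; (M ⊕ κ(X), κ, Y)) ≤ 2^{l−c}/ln 2, where ⊕ is bitwise XOR and mutual information is measured in bits. -/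
open scoped BigOperators Classical

noncomputable section

open OT

namespace OT

lemma dst_eq_sum {Ω α : Type*} [Fintype Ω] (μ : Ω → ℝ) (X : Ω → α) (a : α) :
    dst μ X a = ∑ ω, if X ω = a then μ ω else 0 := by
  unfold dst pr
  refine Finset.sum_congr rfl fun ω _ => ?_
  simp [Set.indicator_apply]

lemma dst_nonneg {Ω α : Type*} [Fintype Ω] (μ : Ω → ℝ) (h : ∀ ω, 0 ≤ μ ω) (X : Ω → α) (a : α) :
    0 ≤ dst μ X a := by
  rw [dst_eq_sum]
  refine Finset.sum_nonneg fun ω _ => ?_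
  split_ifs
  · exact h ω
  · exact le_rfl

lemma dst_sum {Ω α : Type*} [Fintype Ω] [Fintype α] (μ : Ω → ℝ) (X : Ω → α) :
    ∑ a, dst μ X a = ∑ ω, μ ω := by
  simp_rw [dst_eq_sum]
  rw [Finset.sum_comm]
  simp

lemma dst_pair_right {Ω α β : Type*} [Fintype Ω] [Fintype α] [Fintype β] (μ : Ω → ℝ)
    (A : Ω → α) (B : Ω → β) (a : α) :
    ∑ b, dst μ (fun ω => (A ω, B ω)) (a, b) = dst μ A a := by
  simp_rw [dst_eq_sum]
  rw [Finset.sum_comm]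
  refine Finset.sum_congr rfl fun ω _ => ?_
  by_cases h : A ω = a <;> simp [h]

lemma dst_pair_left {Ω α β : Type*} [Fintype Ω] [Fintype α] [Fintype β] (μ : Ω → ℝ)
    (A : Ω → α) (B : Ω → β) (b : β) :
    ∑ a, dst μ (fun ω => (A ω, B ω)) (a, b) = dst μ B b := by
  simp_rw [dst_eq_sum]
  rw [Finset.sum_comm]
  refine Finset.sum_congr rfl fun ω _ => ?_
  by_cases h : B ω = b <;> simp [h]

lemma mi_le {Ω α β : Type*} [Fintype Ω] [Fintype α] [Fintype β] (μ : Ω → ℝ) (hμ : isDist μ)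
    (A : Ω → α) (B : Ω → β) :
    mi μ A B ≤ (∑ a, ∑ b, dst μ (fun ω => (A ω, B ω)) (a, b) ^ 2 / (dst μ A a * dst μ B b) - 1)
      / Real.log 2 := by
  have hl : 0 < Real.log 2 := Real.log_pos (by norm_num)
  set J := dst μ (fun ω => (A ω, B ω)) with hJ
  have hJ0 : ∀ q, 0 ≤ J q := fun q => dst_nonneg μ hμ.1 _ q
  have hJs : ∑ a, ∑ b, J (a, b) = 1 := by
    rw [← Fintype.sum_prod_type', ← hμ.2, ← dst_sum μ (fun ω => (A ω, B ω))]
  have e1 : ent μ A = ∑ a, ∑ b, -(J (a, b) * Real.logb 2 (dst μ A a)) := by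
    unfold ent entD
    refine Finset.sum_congr rfl fun a _ => ?_
    rw [Finset.sum_neg_distrib, ← Finset.sum_mul, hJ, dst_pair_right]
  have e2 : ent μ B = ∑ a, ∑ b, -(J (a, b) * Real.logb 2 (dst μ B b)) := by
    unfold ent entD
    rw [Finset.sum_comm]
    refine Finset.sum_congr rfl fun a _ => ?_
    rw [Finset.sum_neg_distrib, ← Finset.sum_mul, hJ, dst_pair_left]
  have e3 : ent μ (fun ω => (A ω, B ω)) = ∑ a, ∑ b, -(J (a, b) * Real.logb 2 (J (a, b))) := by
    unfold ent entD
    rw [Fintype.sum_prod_type]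
  unfold mi
  rw [e1, e2, e3, ← hJs]
  simp_rw [← Finset.sum_add_distrib, ← Finset.sum_sub_distrib]
  simp_rw [Finset.sum_div]
  refine Finset.sum_le_sum fun a _ => Finset.sum_le_sum fun b _ => ?_
  rcases (hJ0 (a, b)).eq_or_lt with h | h
  · simp [← h]
  have ha : 0 < dst μ A a := by
    rw [← dst_pair_right μ A B a]
    exact h.trans_le (Finset.single_le_sum (f := fun b => J (a, b)) (fun b _ => hJ0 (a, b)) (Finset.mem_univ b))
  have hb : 0 < dst μ B b := by
    rw [← dst_pair_left μ A B b]
    exact h.trans_le (Finset.single_le_sum (f := fun a => J (a, b)) (fun a _ => hJ0 (a, b)) (Finset.mem_univ a))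
  rw [le_div_iff₀ hl]
  have key := Real.log_le_sub_one_of_pos (div_pos h (mul_pos ha hb))
  rw [Real.log_div h.ne' (mul_pos ha hb).ne', Real.log_mul ha.ne' hb.ne'] at key
  have := mul_le_mul_of_nonneg_left key h.le
  simp only [Real.logb]
  calc _ = J (a, b) * (Real.log (J (a, b)) - (Real.log (dst μ A a) + Real.log (dst μ B b))) := by
        field_simp; ring
    _ ≤ _ := this
    _ = _ := by ring

lemma hash_bound {𝒳 K H : Type*} [Fintype 𝒳] [Fintype K] [Nonempty K] [Fintype H] [DecidableEq H]
    (f : K → 𝒳 → H) (e : ℝ) (he : 0 ≤ e)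
    (huniv : ∀ x x' : 𝒳, x ≠ x' →
      ((Finset.univ.filter fun k : K => f k x = f k x').card : ℝ) / Fintype.card K ≤ e)
    (w : 𝒳 → ℝ) (hw : ∀ x, 0 ≤ w x) :
    ∑ k, ∑ h, (∑ x, if f k x = h then w x else 0) ^ 2
      ≤ Fintype.card K * (∑ x, w x ^ 2 + e * (∑ x, w x) ^ 2) := by
  have hN : (0 : ℝ) < Fintype.card K := by exact_mod_cast Fintype.card_pos
  have e1 : ∑ k, ∑ h, (∑ x, if f k x = h then w x else 0) ^ 2
      = ∑ x, ∑ x', w x * w x' * ((Finset.univ.filter fun k : K => f k x = f k x').card : ℝ) := by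
    have : ∀ k, ∑ h, (∑ x, if f k x = h then w x else 0) ^ 2
        = ∑ x, ∑ x', if f k x = f k x' then w x * w x' else 0 := by
      intro k
      simp_rw [sq, Finset.sum_mul_sum]
      rw [Finset.sum_comm]
      refine Finset.sum_congr rfl fun x _ => ?_
      rw [Finset.sum_comm]
      refine Finset.sum_congr rfl fun x' _ => ?_
      simp only [ite_mul, zero_mul, Finset.sum_ite_eq, Finset.mem_univ, if_true, mul_ite, mul_zero]
    simp_rw [this]
    rw [Finset.sum_comm]
    refine Finset.sum_congr rfl fun x _ => ?_
    rw [Finset.sum_comm]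
    refine Finset.sum_congr rfl fun x' _ => ?_
    rw [← Finset.sum_filter, Finset.sum_const, nsmul_eq_mul, mul_comm]
  have e2 : (Fintype.card K : ℝ) * (∑ x, w x ^ 2 + e * (∑ x, w x) ^ 2)
      = ∑ x, ∑ x', w x * w x' * ((Fintype.card K : ℝ) * ((if x = x' then 1 else 0) + e)) := by
    simp_rw [mul_add, Finset.sum_add_distrib]
    congr 1
    · simp [Finset.mul_sum, sq, mul_comm]
    · rw [sq, Finset.sum_mul_sum]
      simp_rw [Finset.mul_sum]
      refine Finset.sum_congr rfl fun x _ => Finset.sum_congr rfl fun x' _ => by ring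
  rw [e1, e2]
  refine Finset.sum_le_sum fun x _ => Finset.sum_le_sum fun x' _ => ?_
  refine mul_le_mul_of_nonneg_left ?_ (mul_nonneg (hw x) (hw x'))
  by_cases h : x = x'
  · subst h
    simp
    nlinarith
  · have := huniv x x' h
    rw [div_le_iff₀ hN] at this
    simp [h]
    linarith

lemma xor_iff {l : ℕ} (m h s : Fin l → Bool) :
    (fun i => xor (m i) (h i)) = s ↔ h = fun i => xor (m i) (s i) := by
  constructor
  · rintro rfl; funext i; simp
  · rintro rfl; funext i; simp

lemma xor_iff' {l : ℕ} (m h s : Fin l → Bool) :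
    (fun i => xor (m i) (h i)) = s ↔ m = fun i => xor (s i) (h i) := by
  constructor
  · rintro rfl; funext i; simp
  · rintro rfl; funext i; simp

lemma sum_xor {l : ℕ} (F : (Fin l → Bool) → ℝ) :
    ∑ m : Fin l → Bool, ∑ s : Fin l → Bool, F (fun i => xor (m i) (s i)) = 2 ^ l * ∑ h, F h := by
  have : ∀ m : Fin l → Bool, ∑ s : Fin l → Bool, F (fun i => xor (m i) (s i)) = ∑ h, F h := by
    intro m
    have hi : Function.Involutive (fun (s : Fin l → Bool) => (fun i => xor (m i) (s i))) := by
      intro s; funext i; simp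
    exact Equiv.sum_comp hi.toPerm F
  simp_rw [this]
  simp

end OT

set_option maxHeartbeats 1000000

/-- hash-then-one-time-pad security: if `H₂(X|Y=y) ≥ c` for every `y` in the
support of `Y`, `κ` is uniform on a two-universal family `K` of hash functions
`𝒳 → {0,1}^l` independent of `(X,Y)`, and `M` is uniform on `{0,1}^l` independent of
`(X,Y,κ)` (both modelled by the product measure on `Ω × K × {0,1}^l`), then
`I(M; (M ⊕ κ(X), κ, Y)) ≤ 2^{l−c}/ln 2`. -/
theorem statement16 {Ω 𝒳 𝒴 K : Type*} [Fintype Ω] [Fintype 𝒳] [Fintype 𝒴] [Fintype K]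
    [Nonempty K]
    (μ : Ω → ℝ) (hμ : isDist μ) (X : Ω → 𝒳) (Y : Ω → 𝒴) (l : ℕ)
    (f : K → 𝒳 → (Fin l → Bool))
    (huniv : ∀ x x' : 𝒳, x ≠ x' →
      ((Finset.univ.filter fun k : K => f k x = f k x').card : ℝ) / Fintype.card K
        ≤ 2 ^ (-(l : ℝ)))
    (c : ℝ)
    (hc : ∀ y, 0 < dst μ Y y → c ≤ ren2 (cnd μ {ω | Y ω = y}) X) :
    mi (fun q : Ω × K × (Fin l → Bool) => μ q.1 / ((Fintype.card K : ℝ) * 2 ^ l))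
      (fun q => q.2.2)
      (fun q => (fun i => xor (q.2.2 i) (f q.2.1 (X q.1) i), q.2.1, Y q.1))
      ≤ 2 ^ ((l : ℝ) - c) / Real.log 2 := by
  have hN : (0 : ℝ) < Fintype.card K := by exact_mod_cast Fintype.card_pos
  have hL : (0 : ℝ) < 2 ^ l := by positivity
  have hl : 0 < Real.log 2 := Real.log_pos (by norm_num)
  set ν : Ω × K × (Fin l → Bool) → ℝ :=
    fun q => μ q.1 / ((Fintype.card K : ℝ) * 2 ^ l) with hν
  have hνd : isDist ν := by
    constructor
    · intro q; exact div_nonneg (hμ.1 _) (by positivity)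
    · simp only [hν, Fintype.sum_prod_type, Finset.sum_const, Finset.card_univ, nsmul_eq_mul,
        Fintype.card_prod, Fintype.card_fun, Fintype.card_bool, Fintype.card_fin]
      rw [← Finset.mul_sum, ← Finset.sum_div, hμ.2]
      push_cast
      field_simp
  refine (mi_le ν hνd _ _).trans ?_
  refine div_le_div_of_nonneg_right ?_ hl.le
  let w : 𝒴 → 𝒳 → ℝ := fun y x => ∑ ω, if X ω = x ∧ Y ω = y then μ ω else 0
  let g : 𝒴 → K → (Fin l → Bool) → ℝ := fun y k h => ∑ x, if f k x = h then w y x else 0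
  have hw0 : ∀ y x, 0 ≤ w y x := by
    intro y x
    refine Finset.sum_nonneg fun ω _ => ?_
    split_ifs
    · exact hμ.1 ω
    · exact le_rfl
  have hg : ∀ y k h, g y k h = ∑ ω, if f k (X ω) = h ∧ Y ω = y then μ ω else 0 := by
    intro y k h
    simp only [g, w, ← Finset.sum_filter (fun x => f k x = h)]
    rw [Finset.sum_comm]
    refine Finset.sum_congr rfl fun ω _ => ?_
    rw [Finset.sum_filter]
    by_cases h1 : Y ω = y
    · simp only [h1, and_true]
      rw [Finset.sum_eq_single (X ω)]
      · simp
      · intro b _ hb; simp [hb.symm]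
      · simp
    · simp [h1]
  have hws : ∀ y, ∑ x, w y x = dst μ Y y := by
    intro y
    rw [dst_eq_sum]
    simp only [w]
    rw [Finset.sum_comm]
    refine Finset.sum_congr rfl fun ω _ => ?_
    by_cases h1 : Y ω = y <;> simp [h1]
  have dM : ∀ m, dst ν (fun q => q.2.2) m = 1 / 2 ^ l := by
    intro m
    rw [dst_eq_sum]
    simp only [hν, Fintype.sum_prod_type, Finset.sum_ite_eq', Finset.mem_univ, if_true,
      Finset.sum_const, Finset.card_univ, nsmul_eq_mul]
    rw [← Finset.mul_sum, ← Finset.sum_div, hμ.2]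
    field_simp
  have dZ : ∀ s k y, dst ν (fun q => ((fun i => xor (q.2.2 i) (f q.2.1 (X q.1) i)), q.2.1, Y q.1))
      (s, k, y) = dst μ Y y / (Fintype.card K * 2 ^ l) := by
    intro s k y
    rw [dst_eq_sum, dst_eq_sum, Fintype.sum_prod_type, Finset.sum_div]
    refine Finset.sum_congr rfl fun ω _ => ?_
    rw [Fintype.sum_prod_type]
    simp only [Prod.mk.injEq, xor_iff', hν]
    rw [Finset.sum_eq_single k]
    · by_cases h1 : Y ω = y <;> simp [h1]
    · intro b _ hb; simp [hb]
    · simp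
  have dJ : ∀ m s k y, dst ν (fun q => (q.2.2,
      ((fun i => xor (q.2.2 i) (f q.2.1 (X q.1) i)), q.2.1, Y q.1)))
      (m, (s, k, y)) = g y k (fun i => xor (m i) (s i)) / (Fintype.card K * 2 ^ l) := by
    intro m s k y
    rw [dst_eq_sum, hg, Fintype.sum_prod_type, Finset.sum_div]
    refine Finset.sum_congr rfl fun ω _ => ?_
    rw [Fintype.sum_prod_type]
    simp only [Prod.mk.injEq, hν]
    rw [Finset.sum_eq_single k]
    · rw [Finset.sum_eq_single m]
      · simp only [true_and, xor_iff]
        by_cases h1 : Y ω = y <;> simp [h1, ite_div]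
      · intro b _ hb; simp [hb]
      · simp
    · intro b _ hb; simp [hb]
    · simp
  have main : ∀ y, (∑ k, ∑ h, g y k h ^ 2) / (Fintype.card K * dst μ Y y) * 2 ^ l
      ≤ dst μ Y y * (2 ^ ((l : ℝ) - c) + 1) := by
    intro y
    rcases (dst_nonneg μ hμ.1 Y y).eq_or_lt with h0 | hp
    · simp [← h0]
    have hb := hash_bound f (2 ^ (-(l : ℝ))) (by positivity) huniv (w y) (hw0 y)
    rw [hws] at hb
    have hcy := hc y hp
    have hd : ∀ x, dst (cnd μ {ω | Y ω = y}) X x = w y x / dst μ Y y := by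
      intro x
      rw [dst_eq_sum]
      simp only [w, Finset.sum_div]
      refine Finset.sum_congr rfl fun ω _ => ?_
      simp only [cnd, Set.indicator_apply, Set.mem_ofPred_eq]
      change (if X ω = x then (if Y ω = y then μ ω else 0) / dst μ Y y else 0) = _
      by_cases h1 : X ω = x <;> by_cases h2 : Y ω = y <;> simp [h1, h2]
    have hS : ∑ x, dst (cnd μ {ω | Y ω = y}) X x ^ 2 = (∑ x, w y x ^ 2) / dst μ Y y ^ 2 := by
      simp_rw [hd, div_pow, Finset.sum_div]
    have hSpos : 0 < ∑ x, w y x ^ 2 := by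
      obtain ⟨x, _, hx⟩ : ∃ x ∈ Finset.univ, 0 < w y x := by
        by_contra! hcon
        have := Finset.sum_nonpos hcon
        rw [hws] at this
        linarith
      exact Finset.sum_pos' (fun _ _ => sq_nonneg _) ⟨x, Finset.mem_univ x, by positivity⟩
    have hS2 : ∑ x, w y x ^ 2 ≤ 2 ^ (-c) * dst μ Y y ^ 2 := by
      unfold ren2 at hcy
      rw [hS, Real.le_logb_iff_rpow_le (by norm_num) (by positivity), one_div_div,
        le_div_iff₀ hSpos] at hcy
      rw [Real.rpow_neg (by norm_num), inv_mul_eq_div, le_div_iff₀ (by positivity)]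
      linarith
    have hb2 : ∑ k, ∑ h, g y k h ^ 2
        ≤ Fintype.card K * (2 ^ (-c) * dst μ Y y ^ 2 + 2 ^ (-(l : ℝ)) * dst μ Y y ^ 2) :=
      hb.trans (by gcongr)
    rw [Real.rpow_sub (by norm_num), Real.rpow_natCast]
    rw [Real.rpow_neg (by norm_num), Real.rpow_neg (by norm_num), Real.rpow_natCast] at hb2
    have hC : (0 : ℝ) < 2 ^ c := by positivity
    calc _ ≤ (Fintype.card K * ((2 ^ c)⁻¹ * dst μ Y y ^ 2 + (2 ^ l)⁻¹ * dst μ Y y ^ 2))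
          / (Fintype.card K * dst μ Y y) * 2 ^ l := by gcongr
      _ = _ := by field_simp
  have hsum : ∑ m : Fin l → Bool, ∑ b : (Fin l → Bool) × K × 𝒴,
      dst ν (fun q => (q.2.2,
        ((fun i => xor (q.2.2 i) (f q.2.1 (X q.1) i)), q.2.1, Y q.1))) (m, b) ^ 2 /
      (dst ν (fun q => q.2.2) m *
        dst ν (fun q => ((fun i => xor (q.2.2 i) (f q.2.1 (X q.1) i)), q.2.1, Y q.1)) b)
      = ∑ y, (∑ k, ∑ h, g y k h ^ 2) / (Fintype.card K * dst μ Y y) * 2 ^ l := by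
    have hterm : ∀ m : Fin l → Bool, ∀ s k y,
        dst ν (fun q => (q.2.2,
        ((fun i => xor (q.2.2 i) (f q.2.1 (X q.1) i)), q.2.1, Y q.1))) (m, (s, k, y)) ^ 2 /
      (dst ν (fun q => q.2.2) m *
        dst ν (fun q => ((fun i => xor (q.2.2 i) (f q.2.1 (X q.1) i)), q.2.1, Y q.1)) (s, k, y))
        = g y k (fun i => xor (m i) (s i)) ^ 2 / (Fintype.card K * dst μ Y y) := by
      intro m s k y
      rw [dJ, dM, dZ]
      by_cases h0 : dst μ Y y = 0
      · simp [h0]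
      · field_simp
    simp_rw [Fintype.sum_prod_type, hterm]
    rw [sum_xor (fun h => ∑ k, ∑ y, g y k h ^ 2 / (Fintype.card K * dst μ Y y)),
      mul_comm, Finset.sum_mul]
    simp_rw [Finset.sum_div, Finset.sum_mul]
    rw [Finset.sum_comm]
    conv_rhs => rw [Finset.sum_comm]
    refine Finset.sum_congr rfl fun k _ => ?_
    rw [Finset.sum_comm]
  rw [hsum]
  have := Finset.sum_le_sum fun y (_ : y ∈ Finset.univ) => main y
  rw [← Finset.sum_mul Finset.univ (fun y => dst μ Y y), dst_sum, hμ.2] at this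
  linarith
end
end
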